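/- arXiv:1905.03811 — 2 statements merged into one kernel-verified Lean document; each statement's English description precedes it below -/
import Mathlib

section
/- For every ε > 0 there exists k₀ such that for all integers k ≥ k₀ the following holds: T_k ≤ k² · e^{(1+ε)(ln ln k)²}, where T_k is the least positive integer t such that for every positive integer n, every equinumerous t-coloring of {1,...,tn} contains a rainbow k-term arithmetic progression. -/
/-- `T k` is the least positive integer `t` such that for every positive integer `n`,
every equinumerous `t`-coloring of `{1, …, t*n}` (a coloring by colors `{1, …, t}` in
which every color class has exactly `n` elements) contains a rainbow `k`-term
arithmetic progression. -/
noncomputable def rainbowT (k : ℕ) : ℕ :=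
  sInf {t : ℕ | 0 < t ∧ ∀ n : ℕ, 0 < n → ∀ c : ℕ → ℕ,
    (∀ x ∈ Finset.Icc 1 (t * n), c x ∈ Finset.Icc 1 t) →
    (∀ col ∈ Finset.Icc 1 t,
      ((Finset.Icc 1 (t * n)).filter (fun x => c x = col)).card = n) →
    ∃ a d : ℕ, 1 ≤ a ∧ 1 ≤ d ∧ a + (k - 1) * d ≤ t * n ∧
      ∀ i j : ℕ, i < k → j < k → i ≠ j → c (a + i * d) ≠ c (a + j * d)}

open Finset in
theorem alternating_sum_powerset_card_le {α : Type*} [DecidableEq α] {r : ℕ} (hr : Odd r) (Q : Finset α) :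
    ∑ T ∈ Q.powerset with #T ≤ r, (-1 : ℤ) ^ #T ≤ if Q = ∅ then 1 else 0 := by
  have h : ∑ T ∈ Q.powerset with #T ≤ r, (-1 : ℤ) ^ #T
      = ∑ j ∈ range (r + 1), (-1) ^ j * ((#Q).choose j : ℤ) := by
    rw [← sum_fiberwise_of_maps_to (g := Finset.card) (t := range (r + 1))
      (fun T hT => by simp only [mem_filter] at hT; simp only [mem_range]; omega)]
    refine sum_congr rfl fun j hj => ?_
    have hT : {T ∈ {T ∈ Q.powerset | #T ≤ r} | #T = j} = powersetCard j Q := by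
      ext T
      simp only [mem_filter, mem_powerset, mem_powersetCard, mem_range] at hj ⊢
      grind
    rw [hT, sum_congr rfl (g := fun _ => (-1 : ℤ) ^ j)
      (fun T hT => by rw [(mem_powersetCard.1 hT).2])]
    simp [mul_comm]
  rw [h]
  rcases Nat.eq_zero_or_eq_succ_pred #Q with h0 | h1
  · rw [if_pos (card_eq_zero.1 h0), h0, sum_range_succ']
    simp
  · rw [h1, Nat.succ_eq_add_one, Int.alternating_sum_range_choose_eq_choose, hr.neg_one_pow]
    split_ifs with h2
    · rw [h2] at h1; simp at h1
    · simp

open Finset in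
theorem sum_prod_powerset_card_gt_le {α : Type*} (Q : Finset α) {f : α → ℝ}
    (hf : ∀ i ∈ Q, 0 ≤ f i) (r : ℕ) :
    ∑ T ∈ Q.powerset with r < #T, ∏ i ∈ T, f i
      ≤ Real.exp (Real.exp 1 * ∑ i ∈ Q, f i - r) := by
  calc ∑ T ∈ Q.powerset with r < #T, ∏ i ∈ T, f i
      ≤ ∑ T ∈ Q.powerset with r < #T, Real.exp (-r) * ∏ i ∈ T, (Real.exp 1 * f i) := by
        refine sum_le_sum fun T hT => ?_
        rw [mem_filter, mem_powerset] at hT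
        have h0 : 0 ≤ ∏ i ∈ T, f i := prod_nonneg fun i hi => hf i (hT.1 hi)
        rw [prod_mul_distrib, prod_const, ← Real.exp_nat_mul, ← mul_assoc, ← Real.exp_add]
        refine le_mul_of_one_le_left h0 (Real.one_le_exp ?_)
        have : (r : ℝ) ≤ #T := by exact_mod_cast hT.2.le
        linarith
    _ ≤ ∑ T ∈ Q.powerset, Real.exp (-r) * ∏ i ∈ T, (Real.exp 1 * f i) := by
        refine sum_le_sum_of_subset_of_nonneg (filter_subset _ _) fun T hT _ => ?_
        refine mul_nonneg (Real.exp_nonneg _) (prod_nonneg fun i hi => ?_)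
        exact mul_nonneg (Real.exp_nonneg _) (hf i (mem_powerset.1 hT hi))
    _ = Real.exp (-r) * ∏ i ∈ Q, (1 + Real.exp 1 * f i) := by
        rw [prod_one_add, mul_sum]
    _ ≤ Real.exp (-r) * ∏ i ∈ Q, Real.exp (Real.exp 1 * f i) := by
        gcongr with i hi
        · intro i hi
          have := mul_nonneg (Real.exp_nonneg 1) (hf i hi)
          linarith
        · rw [add_comm]; exact Real.add_one_le_exp _
    _ = Real.exp (Real.exp 1 * ∑ i ∈ Q, f i - r) := by
        rw [← Real.exp_sum, ← Real.exp_add, mul_sum, neg_add_eq_sub]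

open Finset in
theorem exp_sub_exp_le_alternating_sum {α : Type*} (Q : Finset α) {f : α → ℝ}
    (hf : ∀ i ∈ Q, 0 ≤ f i) (hf' : ∀ i ∈ Q, f i ≤ 1 / 2) (r : ℕ) :
    Real.exp (-2 * ∑ i ∈ Q, f i) - Real.exp (Real.exp 1 * ∑ i ∈ Q, f i - r)
      ≤ ∑ T ∈ Q.powerset with #T ≤ r, (-1) ^ #T * ∏ i ∈ T, f i := by
  have h1 : Real.exp (-2 * ∑ i ∈ Q, f i) ≤ ∏ i ∈ Q, (1 + -f i) := by
    rw [mul_sum, Real.exp_sum]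
    refine prod_le_prod (fun i _ => Real.exp_nonneg _) fun i hi => ?_
    have h0 := hf i hi
    have h2 := hf' i hi
    rw [neg_mul, Real.exp_neg, inv_le_comm₀ (Real.exp_pos _) (by linarith)]
    refine le_trans ?_ (Real.add_one_le_exp _)
    rw [inv_le_iff_one_le_mul₀ (by linarith)]
    nlinarith
  have h2 := sum_prod_powerset_card_gt_le Q hf r
  have h3 : ∏ i ∈ Q, (1 + -f i) = ∑ T ∈ Q.powerset with #T ≤ r, (-1) ^ #T * ∏ i ∈ T, f i
      + ∑ T ∈ Q.powerset with r < #T, (-1) ^ #T * ∏ i ∈ T, f i := by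
    rw [prod_one_add, ← sum_filter_add_sum_filter_not Q.powerset (fun T => #T ≤ r)]
    simp only [prod_neg, not_le]
  have h4 : ∑ T ∈ Q.powerset with r < #T, (-1) ^ #T * ∏ i ∈ T, f i
      ≤ ∑ T ∈ Q.powerset with r < #T, ∏ i ∈ T, f i := by
    refine sum_le_sum fun T hT => ?_
    rw [mem_filter, mem_powerset] at hT
    have h0 : 0 ≤ ∏ i ∈ T, f i := prod_nonneg fun i hi => hf i (hT.1 hi)
    rcases neg_one_pow_eq_or ℝ #T with h | h <;> rw [h] <;> linarith
  linarith

open Finset in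
theorem card_powerset_card_le_le {α : Type*} (Q : Finset α) {k : ℕ} (hk : 0 < k) (hQ : #Q ≤ k)
    (r : ℕ) : (#{T ∈ Q.powerset | #T ≤ r} : ℝ) ≤ Real.exp 1 * k ^ r := by
  have hk' : (1 : ℝ) ≤ k := by exact_mod_cast hk
  calc (#{T ∈ Q.powerset | #T ≤ r} : ℝ)
      = ∑ T ∈ Q.powerset with #T ≤ r, (1 : ℝ) := by simp
    _ ≤ ∑ T ∈ Q.powerset with #T ≤ r, (k : ℝ) ^ r * ∏ i ∈ T, (k : ℝ)⁻¹ := by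
        refine sum_le_sum fun T hT => ?_
        rw [prod_const, inv_pow, ← div_eq_mul_inv, one_le_div (by positivity)]
        exact pow_le_pow_right₀ hk' (mem_filter.1 hT).2
    _ ≤ ∑ T ∈ Q.powerset, (k : ℝ) ^ r * ∏ i ∈ T, (k : ℝ)⁻¹ :=
        sum_le_sum_of_subset_of_nonneg (filter_subset _ _) fun T _ _ => by positivity
    _ = (k : ℝ) ^ r * (1 + (k : ℝ)⁻¹) ^ #Q := by
        rw [← mul_sum, ← prod_one_add, prod_const]
    _ ≤ (k : ℝ) ^ r * Real.exp ((k : ℝ)⁻¹) ^ k := by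
        gcongr
        refine (pow_le_pow_right₀ (by simp) hQ).trans ?_
        gcongr
        rw [add_comm]; exact Real.add_one_le_exp _
    _ = Real.exp 1 * k ^ r := by
        rw [← Real.exp_nat_mul, mul_inv_cancel₀ (by positivity), mul_comm]

/-- The positive integers up to `Y` without prime factors up to `k`. -/
def roughUpTo (k Y : ℕ) : Finset ℕ :=
  (Finset.Ioc 0 Y).filter fun d => d.Coprime k.factorial

theorem coprime_factorial_iff_primesLE {k d : ℕ} :
    d.Coprime k.factorial ↔ (Nat.primesLE k).filter (· ∣ d) = ∅ := by
  rw [Finset.filter_eq_empty_iff]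
  constructor
  · intro h p hp hpd
    have hp' := Nat.prime_of_mem_primesLE hp
    exact hp'.one_lt.ne' (Nat.eq_one_of_dvd_coprimes h hpd
      (hp'.dvd_factorial.2 (Nat.le_of_mem_primesLE hp)))
  · intro h
    refine Nat.coprime_of_dvd fun p hp hpd hpk => ?_
    exact h (Nat.mem_primesLE.2 ⟨hp.dvd_factorial.1 hpk, hp⟩) hpd

open Finset in
theorem mul_alternating_sum_sub_card_le_card_roughUpTo (k Y : ℕ) {r : ℕ} (hr : Odd r) :
    Y * ∑ T ∈ (Nat.primesLE k).powerset with #T ≤ r, (-1) ^ #T * ∏ p ∈ T, (1 / p : ℝ)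
      - #{T ∈ (Nat.primesLE k).powerset | #T ≤ r} ≤ #(roughUpTo k Y) := by
  have h1 : ∑ d ∈ Ioc 0 Y, ∑ T ∈ (Nat.primesLE k).powerset with #T ≤ r ∧ ∏ p ∈ T, p ∣ d,
      (-1 : ℤ) ^ #T ≤ #(roughUpTo k Y) := by
    rw [roughUpTo, card_filter]
    push_cast
    refine sum_le_sum fun d _ => ?_
    simp only [coprime_factorial_iff_primesLE]
    refine le_of_eq_of_le (sum_congr ?_ fun _ _ => rfl)
      (alternating_sum_powerset_card_le hr ((Nat.primesLE k).filter (· ∣ d)))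
    ext T
    simp only [mem_filter, mem_powerset]
    constructor
    · rintro ⟨hT, hTr, hTd⟩
      exact ⟨fun p hp => mem_filter.2 ⟨hT hp, (dvd_prod_of_mem _ hp).trans hTd⟩, hTr⟩
    · rintro ⟨hT, hTr⟩
      refine ⟨hT.trans (filter_subset _ _), hTr, ?_⟩
      exact Finset.prod_primes_dvd d
        (fun p hp => (Nat.prime_of_mem_primesLE (mem_filter.1 (hT hp)).1).prime)
        (fun p hp => (mem_filter.1 (hT hp)).2)
  have h2 : ∑ d ∈ Ioc 0 Y, ∑ T ∈ (Nat.primesLE k).powerset with #T ≤ r ∧ ∏ p ∈ T, p ∣ d,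
      (-1 : ℤ) ^ #T = ∑ T ∈ (Nat.primesLE k).powerset with #T ≤ r,
        (-1 : ℤ) ^ #T * (Y / ∏ p ∈ T, p : ℕ) := by
    rw [sum_congr rfl fun d _ => by rw [← filter_filter, sum_filter], sum_comm]
    refine sum_congr rfl fun T _ => ?_
    rw [← sum_filter, sum_const, Nat.Ioc_filter_dvd_card_eq_div]
    simp [mul_comm]
  rw [h2] at h1
  have h3 : (∑ T ∈ (Nat.primesLE k).powerset with #T ≤ r,
        (-1 : ℝ) ^ #T * (Y / ∏ p ∈ T, p : ℕ)) ≤ #(roughUpTo k Y) := by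
    have h := (Int.cast_le (R := ℝ)).2 h1
    simpa only [Int.cast_sum, Int.cast_mul, Int.cast_pow, Int.cast_neg, Int.cast_one,
      Int.cast_natCast] using h
  refine le_trans ?_ h3
  rw [card_eq_sum_ones, mul_sum]
  push_cast
  rw [← sum_sub_distrib]
  refine sum_le_sum fun T hT => ?_
  set q := ∏ p ∈ T, p with hq
  have hqY : (Y : ℝ) * ((-1) ^ #T * ∏ p ∈ T, (1 / p : ℝ)) = (-1) ^ #T * (Y / q : ℝ) := by
    rw [hq]; push_cast; simp only [one_div, prod_inv_distrib]; ring
  rw [hqY]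
  have h4 : ((Y / q : ℕ) : ℝ) ≤ Y / q := Nat.cast_div_le
  have h5 : (Y / q : ℝ) < (Y / q : ℕ) + 1 := by
    rw [← Nat.floor_div_eq_div (K := ℝ)]; exact Nat.lt_floor_add_one _
  rcases neg_one_pow_eq_or ℝ #T with h | h <;> rw [h] <;> linarith

open Finset in
theorem card_roughUpTo_ge_of_odd {k : ℕ} (hk : 0 < k) (Y : ℕ) {r : ℕ} (hr : Odd r)
    (hs : 5 * ∑ p ∈ Nat.primesLE k, (1 / p : ℝ) + 1 ≤ r) :
    Y * (Real.exp (-2 * ∑ p ∈ Nat.primesLE k, (1 / p : ℝ)) / 2) - Real.exp 1 * k ^ r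
      ≤ #(roughUpTo k Y) := by
  refine le_trans ?_ (mul_alternating_sum_sub_card_le_card_roughUpTo k Y hr)
  have h1 := exp_sub_exp_le_alternating_sum (Nat.primesLE k) (f := fun p => (1 / p : ℝ))
    (fun p _ => by positivity) (fun p hp => by
      have : (2 : ℝ) ≤ p := by exact_mod_cast Nat.two_le_of_mem_primesLE hp
      exact one_div_le_one_div_of_le two_pos this) r
  have h2 := card_powerset_card_le_le (Nat.primesLE k) hk (by
    rw [Nat.primesLE_eq_filter_Icc_one]; simpa using card_filter_le (Icc 1 k) Nat.Prime) r
  set s := ∑ p ∈ Nat.primesLE k, (1 / p : ℝ)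
  have hs0 : 0 ≤ s := sum_nonneg fun p _ => by positivity
  have h3 : Real.exp (Real.exp 1 * s - r) ≤ Real.exp (-2 * s) / 2 := by
    have he := Real.exp_one_lt_three
    have h4 : Real.exp (Real.exp 1 * s - r) ≤ Real.exp (-2 * s + -1) :=
      Real.exp_le_exp.2 (by nlinarith)
    have h5 : Real.exp (-1) ≤ 1 / 2 := by
      rw [Real.exp_neg, one_div]
      exact inv_anti₀ two_pos (by linarith [Real.add_one_le_exp 1])
    rw [Real.exp_add] at h4
    nlinarith [Real.exp_pos (-2 * s)]
  gcongr
  linarith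

open Finset in
theorem sum_one_div_primesLE_two_pow_succ_le {m : ℕ} (hm : 0 < m) :
    ∑ p ∈ Nat.primesLE (2 ^ (m + 1)), (1 / p : ℝ)
      ≤ ∑ p ∈ Nat.primesLE (2 ^ m), (1 / p : ℝ) + 4 / m := by
  have hsub : Nat.primesLE (2 ^ m) ⊆ Nat.primesLE (2 ^ (m + 1)) :=
    Nat.primesLE_mono (Nat.pow_le_pow_right two_pos m.le_succ)
  rw [← sum_sdiff hsub, add_comm]
  gcongr
  set D := Nat.primesLE (2 ^ (m + 1)) \ Nat.primesLE (2 ^ m) with hD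
  have hmem : ∀ p ∈ D, (2 : ℝ) ^ m ≤ p := fun p hp => by
    rw [hD, mem_sdiff, Nat.mem_primesLE, Nat.mem_primesLE] at hp
    have : 2 ^ m ≤ p := by grind
    exact_mod_cast this
  have h2 : (0 : ℝ) < 2 ^ m := by positivity
  have hl2 : 0 < Real.log 2 := Real.log_pos one_lt_two
  have hm' : (0 : ℝ) < m := by exact_mod_cast hm
  have hcard : #D * (m * Real.log 2) ≤ 4 * 2 ^ m * Real.log 2 := by
    calc #D * (m * Real.log 2) = ∑ p ∈ D, Real.log (2 ^ m) := by simp [Real.log_pow]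
      _ ≤ ∑ p ∈ D, Real.log p := sum_le_sum fun p hp => Real.log_le_log h2 (hmem p hp)
      _ ≤ ∑ p ∈ Nat.primesLE (2 ^ (m + 1)), Real.log p :=
          sum_le_sum_of_subset_of_nonneg sdiff_subset fun p _ _ => Real.log_natCast_nonneg p
      _ = Chebyshev.theta ((2 ^ (m + 1) : ℕ) : ℝ) := (Chebyshev.theta_eq_sum_primesLE_log _).symm
      _ ≤ Real.log 4 * ((2 ^ (m + 1) : ℕ) : ℝ) := Chebyshev.theta_le_log4_mul_x (by positivity)
      _ = 4 * 2 ^ m * Real.log 2 := by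
          rw [show (4 : ℝ) = 2 ^ 2 by norm_num, Real.log_pow]; push_cast; ring
  have hcard' : #D * (m : ℝ) ≤ 4 * 2 ^ m := by
    rw [← mul_assoc] at hcard; exact le_of_mul_le_mul_right hcard hl2
  calc ∑ p ∈ D, (1 / p : ℝ) ≤ ∑ p ∈ D, (1 / 2 ^ m : ℝ) :=
        sum_le_sum fun p hp => one_div_le_one_div_of_le h2 (hmem p hp)
    _ = #D / 2 ^ m := by simp [div_eq_mul_inv]
    _ ≤ 4 / m := by rw [div_le_div_iff₀ h2 hm']; exact hcard'

open Finset in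
theorem sum_one_div_primesLE_two_pow_le (m : ℕ) :
    ∑ p ∈ Nat.primesLE (2 ^ (m + 1)), (1 / p : ℝ) ≤ 1 / 2 + 4 * harmonic m := by
  induction m with
  | zero =>
    have : Nat.primesLE (2 ^ (0 + 1)) = {2} := by decide
    rw [this]; simp
  | succ m ih =>
    refine (sum_one_div_primesLE_two_pow_succ_le m.succ_pos).trans ?_
    rw [harmonic_succ]
    push_cast at ih ⊢
    rw [div_eq_mul_inv 4]
    linarith

open Finset in
theorem sum_one_div_primesLE_le {k : ℕ} (hk : 3 ≤ k) :
    ∑ p ∈ Nat.primesLE k, (1 / p : ℝ) ≤ 9 + 4 * Real.log (Real.log k) := by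
  have hlog : Nat.log 2 k ≠ 0 := by
    rw [Ne, Nat.log_eq_zero_iff]; omega
  have hsub : Nat.primesLE k ⊆ Nat.primesLE (2 ^ (Nat.log 2 k + 1)) :=
    Nat.primesLE_mono (Nat.lt_pow_succ_log_self one_lt_two k).le
  have hk0 : (0 : ℝ) < k := by positivity
  have hlk : 0 < Real.log k := Real.log_pos (by exact_mod_cast (by omega : 1 < k))
  have h1 : (Nat.log 2 k : ℝ) ≤ 2 * Real.log k := by
    have h2 : (2 : ℝ) ^ Nat.log 2 k ≤ k := by exact_mod_cast Nat.pow_log_le_self 2 (by omega)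
    have h3 := Real.log_le_log (by positivity) h2
    rw [Real.log_pow] at h3
    nlinarith [Real.log_two_gt_d9, (Nat.cast_nonneg (Nat.log 2 k) : (0 : ℝ) ≤ _)]
  have h4 : Real.log (Nat.log 2 k) ≤ 1 + Real.log (Real.log k) := by
    refine (Real.log_le_log (by positivity) h1).trans ?_
    rw [Real.log_mul two_ne_zero hlk.ne']
    linarith [Real.log_two_lt_d9]
  calc ∑ p ∈ Nat.primesLE k, (1 / p : ℝ)
      ≤ ∑ p ∈ Nat.primesLE (2 ^ (Nat.log 2 k + 1)), (1 / p : ℝ) :=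
        sum_le_sum_of_subset_of_nonneg hsub fun p _ _ => by positivity
    _ ≤ 1 / 2 + 4 * harmonic (Nat.log 2 k) := sum_one_div_primesLE_two_pow_le _
    _ ≤ 9 + 4 * Real.log (Real.log k) := by
        linarith [harmonic_le_one_add_log (Nat.log 2 k)]

open Finset in
theorem primeCounting_le_card_roughUpTo_add (k Y : ℕ) :
    Nat.primeCounting Y ≤ #(roughUpTo k Y) + k := by
  have hsub : Nat.primesLE Y ⊆ roughUpTo k Y ∪ Nat.primesLE k := by
    intro p hp
    have hp' := Nat.mem_primesLE.1 hp
    simp only [mem_union, roughUpTo, mem_filter, mem_Ioc, Nat.mem_primesLE]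
    rcases le_or_gt p k with h | h
    · exact Or.inr ⟨h, hp'.2⟩
    · exact Or.inl ⟨⟨hp'.2.pos, hp'.1⟩, hp'.2.coprime_factorial_of_lt h⟩
  rw [← Nat.primesLE_card_eq_primeCounting]
  refine (card_le_card hsub).trans ((card_union_le _ _).trans ?_)
  gcongr
  rw [Nat.primesLE_eq_filter_Icc_one]
  simpa using card_filter_le (Icc 1 k) Nat.Prime

theorem div_two_mul_log_le_primeCounting {Y : ℕ} (hY : 100 ≤ Y) :
    (Y : ℝ) / (2 * Real.log Y) ≤ Nat.primeCounting Y := by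
  refine le_trans ?_ (Chebyshev.pi_ge Y)
  have hY' : (100 : ℝ) ≤ Y := by exact_mod_cast hY
  have hlY : 0 < Real.log Y := Real.log_pos (by linarith)
  rw [← div_div]
  gcongr
  have h1 : Real.log ((Y + 1) / 16) ≤ (Y + 1) / 16 - 1 :=
    Real.log_le_sub_one_of_pos (by positivity)
  rw [Real.log_div (by positivity) (by norm_num), show (16 : ℝ) = 2 ^ 4 by norm_num,
    Real.log_pow] at h1
  push_cast at h1
  nlinarith [Real.log_two_gt_d9, Real.log_two_lt_d9]

open Finset in
theorem card_filter_not_rainbow_le {k t n A Y : ℕ} {c : ℕ → ℕ}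
    (hAY : A + (k - 1) * Y ≤ t * n)
    (hc : ∀ x ∈ Icc 1 (t * n), c x ∈ Icc 1 t)
    (hcard : ∀ col ∈ Icc 1 t, #{x ∈ Icc 1 (t * n) | c x = col} = n) :
    #{q ∈ Icc 1 A ×ˢ roughUpTo k Y |
      ∃ j < k, ∃ i < j, c (q.1 + i * q.2) = c (q.1 + j * q.2)} ≤ k * (t * (n * n)) := by
  set B := {q ∈ Icc 1 A ×ˢ roughUpTo k Y |
      ∃ j < k, ∃ i < j, c (q.1 + i * q.2) = c (q.1 + j * q.2)} with hB
  have hex : ∀ q ∈ B, ∃ ij : ℕ × ℕ, ij.1 < ij.2 ∧ ij.2 < k ∧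
      c (q.1 + ij.1 * q.2) = c (q.1 + ij.2 * q.2) := fun q hq => by
    obtain ⟨j, hj, i, hi, h⟩ := (mem_filter.1 hq).2
    exact ⟨(i, j), hi, hj, h⟩
  choose! F hF using hex
  have hqB : ∀ q ∈ B, (1 ≤ q.1 ∧ q.1 ≤ A) ∧ (0 < q.2 ∧ q.2 ≤ Y) ∧
      q.2.Coprime k.factorial := fun q hq => by
    have := (mem_filter.1 hq).1
    simpa only [mem_product, mem_Icc, roughUpTo, mem_filter, mem_Ioc] using this
  set X : ℕ → Finset ℕ := fun col => {x ∈ Icc 1 (t * n) | c x = col} with hX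
  have hin : ∀ q ∈ B, ∀ i < k, q.1 + i * q.2 ∈ Icc 1 (t * n) := fun q hq i hi => by
    obtain ⟨⟨h1, h2⟩, ⟨h3, h4⟩, -⟩ := hqB q hq
    have : i * q.2 ≤ (k - 1) * Y := Nat.mul_le_mul (by omega) h4
    rw [mem_Icc]
    omega
  calc #B ≤ #(range k ×ˢ (Icc 1 t).sigma fun col => X col ×ˢ X col) := by
        refine card_le_card_of_injOn (fun q => ((F q).1, ⟨c (q.1 + (F q).1 * q.2),
          (q.1 + (F q).1 * q.2, q.1 + (F q).2 * q.2)⟩)) ?_ ?_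
        · intro q hq
          obtain ⟨h1, h2, h3⟩ := hF q hq
          have hi := hin q hq _ (h1.trans h2)
          have hj := hin q hq _ h2
          simp only [hX, coe_product, Set.mem_prod, mem_coe, mem_range, mem_sigma, mem_product,
            mem_filter]
          exact ⟨h1.trans h2, hc _ hi, ⟨hi, trivial⟩, hj, h3.symm⟩
        · intro q hq q' hq' h
          obtain ⟨h1, h2, -⟩ := hF q hq
          obtain ⟨h1', h2', -⟩ := hF q' hq'
          obtain ⟨-, ⟨h3, -⟩, h4⟩ := hqB q hq
          obtain ⟨-, ⟨h3', -⟩, h4'⟩ := hqB q' hq'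
          obtain ⟨a, d⟩ := q
          obtain ⟨a', d'⟩ := q'
          simp only [Prod.mk.injEq, Sigma.mk.injEq] at h
          obtain ⟨hi, -, h⟩ := h
          have h := (Prod.mk.injEq _ _ _ _ ▸ eq_of_heq h :)
          obtain ⟨hx, hy⟩ := h
          simp only at *
          generalize F (a, d) = f at *
          generalize F (a', d') = f' at *
          obtain ⟨i, j⟩ := f
          obtain ⟨i', j'⟩ := f'
          simp only at *
          subst hi
          obtain ⟨m, rfl⟩ := Nat.exists_eq_add_of_lt h1
          obtain ⟨m', rfl⟩ := Nat.exists_eq_add_of_lt h1'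
          have hD : (m + 1) * d = (m' + 1) * d' := by
            zify at hx hy ⊢; linear_combination hy - hx
          have hdvd : ∀ {u v e : ℕ}, u + 1 < k + 1 → e.Coprime k.factorial → u + 1 ∣ (v + 1) * e →
              u + 1 ∣ v + 1 := fun hu he h =>
            (Nat.Coprime.coprime_dvd_right (Nat.dvd_factorial (Nat.succ_pos _) (by omega))
              he).symm.dvd_of_dvd_mul_right h
          have hm : m + 1 = m' + 1 := Nat.dvd_antisymm
            (hdvd (by omega) h4' ⟨d, hD.symm⟩) (hdvd (by omega) h4 ⟨d', hD⟩)
          rw [hm] at hD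
          have hd := Nat.eq_of_mul_eq_mul_left (Nat.succ_pos _) hD
          subst hd
          rw [Nat.add_right_cancel hx]
    _ = k * (t * (n * n)) := by
        rw [card_product, card_sigma, card_range,
          sum_congr rfl (g := fun _ => n * n) fun col hcol => by
            rw [card_product, hX, hcard col hcol]]
        simp

open Finset in
theorem exists_rainbow_of_lt_card_roughUpTo {k t n A Y : ℕ} {c : ℕ → ℕ}
    (hAY : A + (k - 1) * Y ≤ t * n)
    (hlt : k * (t * (n * n)) < A * #(roughUpTo k Y))
    (hc : ∀ x ∈ Icc 1 (t * n), c x ∈ Icc 1 t)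
    (hcard : ∀ col ∈ Icc 1 t, #{x ∈ Icc 1 (t * n) | c x = col} = n) :
    ∃ a d : ℕ, 1 ≤ a ∧ 1 ≤ d ∧ a + (k - 1) * d ≤ t * n ∧
      ∀ i j : ℕ, i < k → j < k → i ≠ j → c (a + i * d) ≠ c (a + j * d) := by
  have hcount := (card_filter_not_rainbow_le hAY hc hcard).trans_lt hlt
  have hprod : A * #(roughUpTo k Y) = #(Icc 1 A ×ˢ roughUpTo k Y) := by simp
  rw [hprod] at hcount
  obtain ⟨⟨a, d⟩, hq, hbad⟩ := exists_mem_notMem_of_card_lt_card hcount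
  have hq' := hq
  simp only [mem_product, mem_Icc, roughUpTo, mem_filter, mem_Ioc] at hq'
  obtain ⟨⟨ha, haA⟩, ⟨hd, hdY⟩, -⟩ := hq'
  refine ⟨a, d, ha, hd, (Nat.add_le_add haA (Nat.mul_le_mul_left _ hdY)).trans hAY, ?_⟩
  intro i j hi hj hij heq
  refine hbad (mem_filter.2 ⟨hq, ?_⟩)
  rcases hij.lt_or_gt with h | h
  · exact ⟨j, hj, i, h, heq⟩
  · exact ⟨i, hi, j, h, heq.symm⟩

open Filter Finset in
theorem eventually_div_log_pow_le_card_roughUpTo :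
    ∀ᶠ k : ℕ in atTop, ∀ Y : ℕ, (k : ℝ) * Real.log k ^ 20 ≤ Y →
      (Y : ℝ) / Real.log k ^ 10 ≤ #(roughUpTo k Y) := by
  have hlog : Tendsto (fun k : ℕ => Real.log k) atTop atTop :=
    Real.tendsto_log_atTop.comp tendsto_natCast_atTop_atTop
  have hloglog : ∀ᶠ x : ℝ in atTop, 49 + 20 * Real.log x ≤ x := by
    have h := Real.isLittleO_log_id_atTop.bound (c := 1 / 40) (by norm_num)
    filter_upwards [h, eventually_ge_atTop 98] with x hx hx'
    have hx0 : (0 : ℝ) ≤ x := by linarith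
    rw [Real.norm_eq_abs, id, Real.norm_of_nonneg hx0] at hx
    linarith [le_abs_self (Real.log x)]
  have hpow : ∀ᶠ k : ℕ in atTop, Real.exp 1 * Real.log k ^ 10 ≤ k := by
    have h := (isLittleO_log_rpow_rpow_atTop (s := 1) 10 one_pos).bound
      (c := (Real.exp 1)⁻¹) (by positivity)
    filter_upwards [tendsto_natCast_atTop_atTop.eventually h] with k hk
    have hl : 0 ≤ Real.log k := Real.log_natCast_nonneg k
    rw [Real.norm_of_nonneg (by positivity), Real.norm_of_nonneg (by positivity), Real.rpow_one,
      ← div_eq_inv_mul, le_div_iff₀ (Real.exp_pos 1), mul_comm] at hk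
    exact_mod_cast hk
  filter_upwards [hlog.eventually hloglog, hpow, eventually_ge_atTop 100,
    hlog.eventually_ge_atTop (4 * Real.exp 18)] with k hk1 hk2 hk3 hk4 Y hY
  set l := Real.log k with hl
  set s := ∑ p ∈ Nat.primesLE k, (1 / p : ℝ) with hs
  have hsu : s ≤ 9 + 4 * Real.log l := sum_one_div_primesLE_le (by omega)
  have hs0 : 0 ≤ s := sum_nonneg fun p _ => by positivity
  have he18 := Real.add_one_le_exp 18
  have hl4 : 4 ≤ l := by linarith
  have hk100 : (100 : ℝ) ≤ k := by exact_mod_cast hk3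
  obtain ⟨r, hr, hr1, hr2⟩ : ∃ r : ℕ, Odd r ∧ 5 * s + 1 ≤ r ∧ (r : ℝ) ≤ 5 * s + 3 := by
    refine ⟨2 * ⌈5 * s / 2⌉₊ + 1, ⟨_, rfl⟩, ?_, ?_⟩
    · push_cast; linarith [Nat.le_ceil (5 * s / 2)]
    · push_cast; linarith [Nat.ceil_lt_add_one (a := 5 * s / 2) (by positivity)]
  have hY0 : (0 : ℝ) ≤ Y := Nat.cast_nonneg Y
  rcases le_total ((k : ℝ) ^ (r + 1)) Y with h | h
  · refine le_trans ?_ (card_roughUpTo_ge_of_odd (by omega) Y hr hr1)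
    rw [← hs]
    have h1 : Real.exp 1 * k ^ r ≤ Y / l ^ 10 := by
      rw [le_div_iff₀ (by positivity)]
      calc Real.exp 1 * k ^ r * l ^ 10 = (k : ℝ) ^ r * (Real.exp 1 * l ^ 10) := by ring
        _ ≤ (k : ℝ) ^ r * k := by gcongr
        _ ≤ Y := by rw [← pow_succ]; exact h
    have h2 : 2 / l ^ 10 ≤ Real.exp (-2 * s) / 2 := by
      have h3 : (Real.exp 18)⁻¹ * (l ^ 8)⁻¹ ≤ Real.exp (-2 * s) := by
        have h4 : l ^ 8 = Real.exp (8 * Real.log l) := by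
          rw [mul_comm, Real.exp_mul, Real.exp_log (by positivity)]; norm_cast
        rw [h4, ← Real.exp_neg, ← Real.exp_neg, ← Real.exp_add]
        exact Real.exp_le_exp.2 (by linarith)
      refine le_trans ?_ (div_le_div_of_nonneg_right h3 two_pos.le)
      rw [← mul_inv, ← one_div, div_div, div_le_div_iff₀ (by positivity) (by positivity)]
      have : 4 * Real.exp 18 ≤ l ^ 2 := by nlinarith
      calc 2 * (Real.exp 18 * l ^ 8 * 2) = 4 * Real.exp 18 * l ^ 8 := by ring
        _ ≤ l ^ 2 * l ^ 8 := by gcongr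
        _ = 1 * l ^ 10 := by ring
    have h5 := mul_le_mul_of_nonneg_left h2 hY0
    have h6 : (Y : ℝ) * (2 / l ^ 10) = 2 * (Y / l ^ 10) := by ring
    linarith
  · have hkY : (k : ℝ) ≤ Y :=
      (le_mul_of_one_le_right (by positivity) (one_le_pow₀ (by linarith))).trans hY
    have hY100 : (100 : ℝ) ≤ Y := hk100.trans hkY
    have hlY : Real.log Y ≤ l ^ 2 := by
      have h1 := Real.log_le_log (by linarith) h
      rw [Real.log_pow] at h1
      push_cast at h1
      nlinarith
    have hlY0 : 0 < Real.log Y := Real.log_pos (by linarith)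
    have h2 := div_two_mul_log_le_primeCounting (Y := Y) (by exact_mod_cast hY100)
    have h3 : (Nat.primeCounting Y : ℝ) ≤ #(roughUpTo k Y) + k := by
      exact_mod_cast primeCounting_le_card_roughUpTo_add k Y
    have h4 : (k : ℝ) ≤ Y / l ^ 10 := by
      rw [le_div_iff₀ (by positivity)]
      refine le_trans ?_ hY
      gcongr
      · linarith
      · norm_num
    have h5 : 2 * (Y / l ^ 10) ≤ Y / (2 * Real.log Y) := by
      rw [← mul_div_assoc, div_le_div_iff₀ (by positivity) (by positivity)]
      have h6 : 4 * Real.log Y ≤ l ^ 10 := by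
        calc 4 * Real.log Y ≤ l ^ 8 * l ^ 2 := by
              gcongr
              exact hl4.trans (le_self_pow₀ (by linarith) (by norm_num))
          _ = l ^ 10 := by ring
      nlinarith
    linarith

open Finset in
theorem exists_rainbow_of_log_pow_le {k t n : ℕ} (hk : 2 ≤ k) (hn : 0 < n)
    (hl : 17 ≤ Real.log k)
    (hrough : ∀ Y : ℕ, (k : ℝ) * Real.log k ^ 20 ≤ Y →
      (Y : ℝ) / Real.log k ^ 10 ≤ #(roughUpTo k Y))
    (ht : (k : ℝ) ^ 2 * Real.log k ^ 21 ≤ t) {c : ℕ → ℕ}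
    (hc : ∀ x ∈ Icc 1 (t * n), c x ∈ Icc 1 t)
    (hcard : ∀ col ∈ Icc 1 t, #{x ∈ Icc 1 (t * n) | c x = col} = n) :
    ∃ a d : ℕ, 1 ≤ a ∧ 1 ≤ d ∧ a + (k - 1) * d ≤ t * n ∧
      ∀ i j : ℕ, i < k → j < k → i ≠ j → c (a + i * d) ≠ c (a + j * d) := by
  set l := Real.log k with hldef
  have hk2 : (2 : ℝ) ≤ k := by exact_mod_cast hk
  have hn1 : (1 : ℝ) ≤ n := by exact_mod_cast hn
  have htN : (t : ℝ) ≤ (t * n : ℕ) := by push_cast; nlinarith [Nat.cast_nonneg (α := ℝ) t]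
  have hl1 : 1 ≤ l := by linarith
  have h21 : 17 * l ^ 20 ≤ l ^ 21 := by
    rw [pow_succ' l 20]; gcongr
  have h20 : 1 ≤ l ^ 20 := one_le_pow₀ hl1
  have hkt : 17 * (k : ℝ) ^ 2 * l ^ 20 ≤ t := by
    refine le_trans ?_ ht
    calc 17 * (k : ℝ) ^ 2 * l ^ 20 = k ^ 2 * (17 * l ^ 20) := by ring
      _ ≤ k ^ 2 * l ^ 21 := by gcongr
  set N := t * n with hN
  have hNk : 17 * (k : ℝ) ^ 2 * l ^ 20 ≤ N := hkt.trans htN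
  have hNk' : 17 * (k : ℝ) ^ 2 ≤ N :=
    (le_mul_of_one_le_right (by positivity) h20).trans hNk
  have hY : (N : ℝ) / (4 * k) ≤ (N / (2 * k) : ℕ) := by
    have h1 : (N / (2 * k) : ℝ) < (N / (2 * k) : ℕ) + 1 := by
      have := Nat.lt_floor_add_one (N / (2 * k : ℕ) : ℝ)
      rw [Nat.floor_div_eq_div] at this
      exact_mod_cast this
    have h2 : (1 : ℝ) ≤ N / (4 * k) := by
      rw [le_div_iff₀ (by positivity)]; nlinarith
    have h3 : (N : ℝ) / (2 * k) = 2 * (N / (4 * k)) := by field_simp; norm_num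
    linarith
  have hA : (N : ℝ) / 4 ≤ (N / 2 : ℕ) := by
    have h1 : (N : ℝ) < 2 * ((N / 2 : ℕ) + 1) := by
      exact_mod_cast (by omega : N < 2 * (N / 2 + 1))
    nlinarith
  have hR := hrough (N / (2 * k)) (by
    refine le_trans ?_ hY
    rw [le_div_iff₀ (by positivity)]
    nlinarith [mul_nonneg (sq_nonneg (k : ℝ)) (zero_le_one.trans h20)])
  refine exists_rainbow_of_lt_card_roughUpTo (A := N / 2) (Y := N / (2 * k)) ?_ ?_ hc hcard
  · have h1 : k * (N / (2 * k)) ≤ N / 2 := by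
      rw [← Nat.div_div_eq_div_mul]; exact Nat.mul_div_le _ _
    have h2 : (k - 1) * (N / (2 * k)) ≤ k * (N / (2 * k)) := Nat.mul_le_mul_right _ (by omega)
    omega
  · have hgoal : (k : ℝ) * (t * (n * n)) < (N / 2 : ℕ) * #(roughUpTo k (N / (2 * k))) := by
      have h10 : l ^ 10 ≤ l ^ 20 := pow_le_pow_right₀ hl1 (by norm_num)
      have ht0 : (0 : ℝ) < t := lt_of_lt_of_le (by positivity) hkt
      calc (k : ℝ) * (t * (n * n)) < N / 4 * (N / (4 * k) / l ^ 10) := by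
            rw [hN, ← mul_div_assoc, lt_div_iff₀ (by positivity), div_mul_div_comm,
              lt_div_iff₀ (by positivity)]
            push_cast
            have h3 : 16 * (k : ℝ) ^ 2 * l ^ 10 < t := by
              refine lt_of_lt_of_le ?_ hkt
              have : 0 < (k : ℝ) ^ 2 * l ^ 10 := by positivity
              nlinarith [mul_le_mul_of_nonneg_left h10 (sq_nonneg (k : ℝ))]
            calc (k : ℝ) * (t * (n * n)) * l ^ 10 * (4 * (4 * k))
                = (t * (n * n) : ℝ) * (16 * k ^ 2 * l ^ 10) := by ring
              _ < (t * (n * n) : ℝ) * t := by gcongr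
              _ = (t * n * (t * n) : ℝ) := by ring
        _ ≤ (N / 2 : ℕ) * ((N / (2 * k) : ℕ) / l ^ 10) := by gcongr
        _ ≤ (N / 2 : ℕ) * #(roughUpTo k (N / (2 * k))) := by gcongr
    exact_mod_cast hgoal

theorem rainbowT_upper_bound :
    ∀ ε : ℝ, 0 < ε → ∃ k₀ : ℕ, ∀ k : ℕ, k₀ ≤ k →
      (rainbowT k : ℝ) ≤
        (k : ℝ) ^ 2 * Real.exp ((1 + ε) * (Real.log (Real.log k)) ^ 2) := by
  intro ε hε
  have hlog : Filter.Tendsto (fun k : ℕ => Real.log k) Filter.atTop Filter.atTop :=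
    Real.tendsto_log_atTop.comp tendsto_natCast_atTop_atTop
  rw [← Filter.eventually_atTop]
  filter_upwards [eventually_div_log_pow_le_card_roughUpTo, Filter.eventually_ge_atTop 2,
    hlog.eventually_ge_atTop 17, (Real.tendsto_log_atTop.comp hlog).eventually_ge_atTop 22]
    with k hrough hk hl hu
  set B := (k : ℝ) ^ 2 * Real.exp ((1 + ε) * (Real.log (Real.log k)) ^ 2) with hB
  have hk2 : (2 : ℝ) ≤ k := by exact_mod_cast hk
  have hl0 : 0 < Real.log k := by linarith
  have hexp : Real.log k ^ 22 ≤ Real.exp ((1 + ε) * (Real.log (Real.log k)) ^ 2) := by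
    have h1 : Real.log k ^ 22 = Real.exp (22 * Real.log (Real.log k)) := by
      rw [mul_comm, Real.exp_mul, Real.exp_log hl0]; norm_cast
    rw [h1]
    simp only [Function.comp] at hu
    refine Real.exp_le_exp.2 ?_
    nlinarith [sq_nonneg (Real.log (Real.log k))]
  have h21 : 1 ≤ (k : ℝ) ^ 2 * Real.log k ^ 21 :=
    one_le_mul_of_one_le_of_one_le (one_le_pow₀ (by linarith)) (one_le_pow₀ (by linarith))
  have hB' : (k : ℝ) ^ 2 * Real.log k ^ 21 + 1 ≤ B := by
    have h1 : (k : ℝ) ^ 2 * Real.log k ^ 22 ≤ B := by rw [hB]; gcongr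
    have h2 : (k : ℝ) ^ 2 * Real.log k ^ 22 = (k ^ 2 * Real.log k ^ 21) * Real.log k := by ring
    nlinarith
  have ht : (k : ℝ) ^ 2 * Real.log k ^ 21 ≤ ⌊B⌋₊ := by linarith [Nat.lt_floor_add_one B]
  have hle : rainbowT k ≤ ⌊B⌋₊ := by
    refine Nat.sInf_le ⟨?_, fun n hn c hc hcard => ?_⟩
    · exact_mod_cast (zero_lt_one.trans_le (h21.trans ht) : (0 : ℝ) < ⌊B⌋₊)
    · exact exists_rainbow_of_log_pow_le hk hn hl hrough ht hc hcard
  exact (Nat.cast_le.2 hle).trans (Nat.floor_le (by linarith))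
end

section
/- For every ε > 0 there exists k₀ such that for all integers k ≥ k₀, setting t = ⌈k² · e^{(1+ε)(ln ln k)²}⌉, the following holds: for every positive integer n and every coloring c : {1,...,tn} → {1,...,t} in which every color class has exactly n elements, there exist integers a ≥ 1 and d ≥ 1 with a+(k-1)d ≤ tn such that the k values c(a), c(a+d), ..., c(a+(k-1)d) are pairwise distinct. -/
/-- The prime factors of `n` that are at most `k`, listed with multiplicity. -/
def smallFactors (k n : ℕ) : List ℕ := n.primeFactorsList.filter (· ≤ k)

namespace smallFactors

theorem perm_mul (k : ℕ) {a b : ℕ} (ha : a ≠ 0) (hb : b ≠ 0) :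
    (smallFactors k (a * b)).Perm (smallFactors k a ++ smallFactors k b) := by
  unfold smallFactors
  rw [← List.filter_append]
  exact (Nat.perm_primeFactorsList_mul ha hb).filter _

theorem eq_primeFactorsList {k l : ℕ} (hlk : l ≤ k) : smallFactors k l = l.primeFactorsList := by
  unfold smallFactors
  rw [List.filter_eq_self]
  intro p hp
  simpa using (Nat.le_of_mem_primeFactorsList hp).trans hlk

theorem length_mul (k : ℕ) {a b : ℕ} (ha : a ≠ 0) (hb : b ≠ 0) :
    (smallFactors k (a * b)).length = (smallFactors k a).length + (smallFactors k b).length := by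
  simpa using (perm_mul k ha hb).length_eq

theorem prod_mul (k : ℕ) {a b : ℕ} (ha : a ≠ 0) (hb : b ≠ 0) :
    (smallFactors k (a * b)).prod = (smallFactors k a).prod * (smallFactors k b).prod := by
  simpa using (perm_mul k ha hb).prod_eq

theorem pos_of_mem {k n p : ℕ} (hp : p ∈ smallFactors k n) : 0 < p :=
  (Nat.prime_of_mem_primeFactorsList (List.mem_of_mem_filter hp)).pos

theorem prod_pos (k n : ℕ) : 0 < (smallFactors k n).prod :=
  List.prod_pos fun _ => pos_of_mem

theorem length_eq_sum_factorization (k n : ℕ) :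
    (smallFactors k n).length = ∑ p ∈ k.primesLE, n.factorization p := by
  have h := Multiset.sum_count_eq_card (s := k.primesLE) (m := (smallFactors k n : Multiset ℕ))
    (fun p hp => by
      simp only [smallFactors, Multiset.mem_coe, List.mem_filter, decide_eq_true_eq] at hp
      exact Nat.mem_primesLE.2 ⟨hp.2, Nat.prime_of_mem_primeFactorsList hp.1⟩)
  rw [Multiset.coe_card] at h
  rw [← h]
  refine Finset.sum_congr rfl fun p hp => ?_
  rw [Multiset.coe_count, smallFactors, List.count_filter, Nat.primeFactorsList_count_eq]
  simpa using Nat.le_of_mem_primesLE hp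

theorem sum_length (k x : ℕ) :
    ∑ d ∈ Finset.Icc 1 x, (smallFactors k d).length = (smallFactors k x.factorial).length := by
  induction x with
  | zero => simp [smallFactors]
  | succ x ih =>
    rw [Finset.sum_Icc_succ_top (by omega), ih, Nat.factorial_succ,
      length_mul k (by omega) x.factorial_ne_zero, add_comm]

theorem sum_length_le (k x : ℕ) :
    (∑ d ∈ Finset.Icc 1 x, (smallFactors k d).length : ℝ) ≤
      x * ∑ p ∈ k.primesLE, ((p : ℝ) - 1)⁻¹ := by
  rw [← Nat.cast_sum, sum_length, length_eq_sum_factorization, Nat.cast_sum, Finset.mul_sum]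
  refine Finset.sum_le_sum fun p hp => ?_
  have hp' := Nat.prime_of_mem_primesLE hp
  calc ((x.factorial.factorization p : ℕ) : ℝ) ≤ ((x / (p - 1) : ℕ) : ℝ) := by
        exact_mod_cast Nat.factorization_factorial_le_div_pred hp' x
    _ ≤ (x : ℝ) / ((p - 1 : ℕ) : ℝ) := Nat.cast_div_le
    _ = _ := by rw [Nat.cast_pred hp'.pos, div_eq_mul_inv]

/-- Most integers up to `x` have few prime factors up to `k` (Markov's inequality). -/
theorem le_card_length_le (k x r : ℕ) :
    (x : ℝ) * (1 - (∑ p ∈ k.primesLE, ((p : ℝ) - 1)⁻¹) / (r + 1)) ≤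
      ((Finset.Icc 1 x).filter fun d => (smallFactors k d).length ≤ r).card := by
  set S := ∑ p ∈ k.primesLE, ((p : ℝ) - 1)⁻¹
  have h₁ : (((Finset.Icc 1 x).filter fun d => ¬ (smallFactors k d).length ≤ r).card : ℝ) * (r + 1)
      ≤ x * S := by
    refine le_trans ?_ (sum_length_le k x)
    have h := Finset.card_nsmul_le_sum
      ((Finset.Icc 1 x).filter fun d => ¬ (smallFactors k d).length ≤ r)
      (fun d => (smallFactors k d).length) (r + 1) (fun d hd => by
        have := (Finset.mem_filter.1 hd).2
        omega)
    have h' := h.trans (Finset.sum_le_sum_of_subset (Finset.filter_subset _ _))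
    rw [smul_eq_mul] at h'
    exact_mod_cast h'
  have h₂ := Finset.card_filter_add_card_filter_not (s := Finset.Icc 1 x)
    (fun d => (smallFactors k d).length ≤ r)
  rw [Nat.card_Icc, Nat.add_sub_cancel] at h₂
  have h₃ : (((Finset.Icc 1 x).filter fun d => (smallFactors k d).length ≤ r).card : ℝ) +
      ((Finset.Icc 1 x).filter fun d => ¬ (smallFactors k d).length ≤ r).card = x := by
    exact_mod_cast h₂
  have hr : (0 : ℝ) < r + 1 := by positivity
  rw [← le_div_iff₀ hr] at h₁
  have : (x : ℝ) * (1 - S / (r + 1)) = x - x * S / (r + 1) := by ring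
  linarith

end smallFactors

open scoped Pointwise in
theorem List.prod_mem_insert_one_pow {T : Finset ℕ} {r : ℕ} {L : List ℕ} (hL : ∀ p ∈ L, p ∈ T)
    (hr : L.length ≤ r) : L.prod ∈ (insert 1 T) ^ r := by
  induction L generalizing r with
  | nil => simpa using Finset.one_mem_pow (Finset.mem_insert_self 1 T)
  | cons p L ih =>
    obtain ⟨r, rfl⟩ : ∃ s, r = s + 1 := ⟨r - 1, by simp at hr; omega⟩
    rw [List.prod_cons, pow_succ']
    simp only [List.length_cons, add_le_add_iff_right] at hr
    exact Finset.mul_mem_mul (Finset.mem_insert_of_mem (hL p (by simp)))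
      (ih (fun q hq => hL q (by simp [hq])) hr)

theorem Nat.length_primeFactorsList_le_log {l : ℕ} (hl : l ≠ 0) :
    l.primeFactorsList.length ≤ Nat.log 2 l := by
  refine (Nat.le_log_iff_pow_le (by norm_num) hl).2 ?_
  conv_rhs => rw [← Nat.prod_primeFactorsList hl]
  exact List.pow_card_le_prod _ 2 fun p hp => (Nat.prime_of_mem_primeFactorsList hp).two_le

open scoped Pointwise in
/-- An integer has few divisors up to `k` whose complementary divisor has at most `r` prime factors
up to `k`. -/
theorem card_divisors_smallFactors_le {k m : ℕ} (r : ℕ) (hm : m ≠ 0) :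
    ((Finset.Icc 1 k).filter fun l => l ∣ m ∧ (smallFactors k (m / l)).length ≤ r).card ≤
      (r + Nat.log 2 k + 1) ^ r := by
  set S := (Finset.Icc 1 k).filter fun l => l ∣ m ∧ (smallFactors k (m / l)).length ≤ r with hS
  have key : ∀ l ∈ S, l ≠ 0 ∧ l ≤ k ∧ m / l ≠ 0 ∧ m = m / l * l ∧
      (smallFactors k (m / l)).length ≤ r := by
    intro l hl
    simp only [hS, Finset.mem_filter, Finset.mem_Icc] at hl
    obtain ⟨⟨h1, hk⟩, hdvd, hlen⟩ := hl
    exact ⟨by omega, hk, (Nat.div_pos (Nat.le_of_dvd (by omega) hdvd) (by omega)).ne',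
      (Nat.div_mul_cancel hdvd).symm, hlen⟩
  rcases S.eq_empty_or_nonempty with h | ⟨l₀, hl₀⟩
  · simp [h]
  set T := (smallFactors k m).toFinset
  have hT : T.card ≤ r + Nat.log 2 k := by
    obtain ⟨h0, hk, hd, he, hlen⟩ := key l₀ hl₀
    refine (List.toFinset_card_le _).trans ?_
    rw [he, smallFactors.length_mul k hd h0, smallFactors.eq_primeFactorsList hk]
    exact add_le_add hlen ((Nat.length_primeFactorsList_le_log h0).trans (Nat.log_mono_right hk))
  calc S.card ≤ ((insert 1 T) ^ r).card := by
        refine Finset.card_le_card_of_injOn (fun l => (smallFactors k (m / l)).prod) ?_ ?_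
        · intro l hl
          obtain ⟨h0, hk, hd, he, hlen⟩ := key l hl
          refine List.prod_mem_insert_one_pow (fun p hp => ?_) hlen
          rw [List.mem_toFinset, he]
          exact (smallFactors.perm_mul k hd h0).mem_iff.2 (List.mem_append_left _ hp)
        · intro l hl l' hl' hll
          obtain ⟨h0, hk, hd, he, -⟩ := key l hl
          obtain ⟨h0', hk', hd', he', -⟩ := key l' hl'
          have e := smallFactors.prod_mul k hd h0
          have e' := smallFactors.prod_mul k hd' h0'
          rw [← he, smallFactors.eq_primeFactorsList hk, Nat.prod_primeFactorsList h0] at e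
          rw [← he', smallFactors.eq_primeFactorsList hk', Nat.prod_primeFactorsList h0'] at e'
          simp only at hll
          rw [e, ← hll] at e'
          exact Nat.eq_of_mul_eq_mul_left (smallFactors.prod_pos k _) e'
    _ ≤ (insert 1 T).card ^ r := Finset.card_pow_le
    _ ≤ _ := Nat.pow_le_pow_left ((Finset.card_insert_le _ _).trans (by omega)) r

/-- The upper bound in the first theorem of Mertens. -/
theorem sum_log_div_primesLE_le {n : ℕ} (hn : n ≠ 0) :
    ∑ p ∈ n.primesLE, Real.log p / p ≤ Real.log n + Real.log 4 := by
  have hn' : (0 : ℝ) < n := by exact_mod_cast Nat.pos_of_ne_zero hn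
  have h₁ : ∑ p ∈ n.primesLE, ((n / p : ℕ) : ℝ) * Real.log p ≤ n * Real.log n := by
    calc ∑ p ∈ n.primesLE, ((n / p : ℕ) : ℝ) * Real.log p
        = Real.log ((∏ p ∈ n.primesLE, p ^ (n / p) : ℕ) : ℝ) := by
          rw [Nat.cast_prod, Real.log_prod]
          · exact Finset.sum_congr rfl fun p _ => by rw [Nat.cast_pow, Real.log_pow]
          · intro p hp
            have := (Nat.prime_of_mem_primesLE hp).ne_zero
            positivity
      _ ≤ Real.log (n.factorial : ℝ) := by
          refine Real.log_le_log ?_ ?_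
          · exact_mod_cast Finset.prod_pos fun p hp =>
              pow_pos (Nat.prime_of_mem_primesLE hp).pos _
          · refine Nat.cast_le.2 (Nat.le_of_dvd n.factorial_pos ?_)
            refine Finset.prod_dvd_of_isRelPrime (fun p hp q hq hpq => ?_) fun p hp => ?_
            · exact Nat.coprime_iff_isRelPrime.1 (Nat.Coprime.pow _ _
                ((Nat.coprime_primes (Nat.prime_of_mem_primesLE hp)
                  (Nat.prime_of_mem_primesLE hq)).2 hpq))
            · have hp' := Nat.prime_of_mem_primesLE hp
              rw [hp'.pow_dvd_factorial_iff (b := Nat.log p n + 2) (by omega)]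
              refine le_trans (by simp) (Finset.single_le_sum (f := fun i => n / p ^ i)
                (fun _ _ => Nat.zero_le _) (Finset.mem_Ico.2 ⟨le_refl 1, by omega⟩))
      _ ≤ Real.log ((n : ℝ) ^ n) := by
          refine Real.log_le_log (by exact_mod_cast n.factorial_pos) ?_
          exact_mod_cast Nat.factorial_le_pow n
      _ = _ := by rw [Real.log_pow]
  have h₂ : ∑ p ∈ n.primesLE, Real.log p ≤ Real.log 4 * n := by
    rw [← Chebyshev.theta_eq_sum_primesLE_log]
    exact Chebyshev.theta_le_log4_mul_x hn'.le
  have h₃ : n * ∑ p ∈ n.primesLE, Real.log p / p ≤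
      ∑ p ∈ n.primesLE, ((n / p : ℕ) : ℝ) * Real.log p + ∑ p ∈ n.primesLE, Real.log p := by
    rw [Finset.mul_sum, ← Finset.sum_add_distrib]
    refine Finset.sum_le_sum fun p hp => ?_
    have hlt : (n : ℝ) / p < (n / p : ℕ) + 1 := by
      rw [← Nat.floor_div_eq_div (K := ℝ)]
      exact Nat.lt_floor_add_one _
    calc (n : ℝ) * (Real.log p / p) = n / p * Real.log p := by ring
      _ ≤ ((n / p : ℕ) + 1) * Real.log p := by
          gcongr
      _ = _ := by ring
  refine le_of_mul_le_mul_left ?_ hn'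
  linarith

/-- The upper bound in the second theorem of Mertens. -/
theorem exists_sum_inv_primesLE_le :
    ∃ C : ℝ, ∀ n : ℕ, 2 ≤ n →
      ∑ p ∈ n.primesLE, (p : ℝ)⁻¹ ≤ Real.log (Real.log n) + C := by
  have main : ∀ n : ℕ, 2 ≤ n → ∑ p ∈ n.primesLE, (p : ℝ)⁻¹ ≤
      (∑ p ∈ n.primesLE, Real.log p / p - Real.log 4) / Real.log n +
        Real.log (Real.log n) + (2 - Real.log (Real.log 2)) := by
    intro n hn
    induction n, hn using Nat.le_induction with
    | base =>
      have h2 : Nat.primesLE 2 = {2} := by decide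
      have hl : 0 < Real.log 2 := Real.log_pos (by norm_num)
      have h4 : Real.log 4 = 2 * Real.log 2 := by
        rw [show (4 : ℝ) = 2 ^ 2 by norm_num, Real.log_pow]; norm_num
      rw [h2, h4]
      simp only [Finset.sum_singleton, Nat.cast_ofNat]
      have : (Real.log 2 / 2 - 2 * Real.log 2) / Real.log 2 = -3 / 2 := by field_simp; norm_num
      rw [this]
      norm_num
    | succ n hn ih =>
      have hA := sum_log_div_primesLE_le (n := n) (by omega)
      have ha : 0 < Real.log n := Real.log_pos (by exact_mod_cast hn)
      have hab : Real.log n ≤ Real.log ((n + 1 : ℕ) : ℝ) :=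
        Real.log_le_log (by positivity) (by push_cast; linarith)
      have hb : 0 < Real.log ((n + 1 : ℕ) : ℝ) := ha.trans_le hab
      set a := Real.log n
      set b := Real.log ((n + 1 : ℕ) : ℝ) with hbdef
      set A := ∑ p ∈ n.primesLE, Real.log p / p
      have hinc : ∑ p ∈ (n + 1).primesLE, (p : ℝ)⁻¹ - ∑ p ∈ n.primesLE, (p : ℝ)⁻¹ =
          (∑ p ∈ (n + 1).primesLE, Real.log p / p - A) / b := by
        rw [Nat.primesLE_succ]
        split_ifs
        · rw [Finset.sum_insert (Nat.notMem_primesLE n), Finset.sum_insert (Nat.notMem_primesLE n),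
            add_sub_cancel_right, add_sub_cancel_right, ← hbdef]
          field_simp
        · simp [A]
      have hlog : 1 - a / b ≤ Real.log b - Real.log a := by
        have := Real.one_sub_inv_le_log_of_pos (div_pos hb ha)
        rwa [inv_div, Real.log_div hb.ne' ha.ne'] at this
      have hstep : (A - Real.log 4) / a - (A - Real.log 4) / b ≤ 1 - a / b := by
        have : (A - Real.log 4) / a - (A - Real.log 4) / b =
            (A - Real.log 4) * (1 / a - 1 / b) := by ring
        rw [this]
        have h0 : 0 ≤ 1 / a - 1 / b := sub_nonneg.2 (one_div_le_one_div_of_le ha hab)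
        calc (A - Real.log 4) * (1 / a - 1 / b) ≤ a * (1 / a - 1 / b) := by
              gcongr; linarith
          _ = 1 - a / b := by field_simp
      have e : (∑ p ∈ (n + 1).primesLE, Real.log p / p - Real.log 4) / b =
          (∑ p ∈ (n + 1).primesLE, Real.log p / p - A) / b + (A - Real.log 4) / b := by ring
      rw [e]
      linarith
  refine ⟨1 + (2 - Real.log (Real.log 2)), fun n hn => (main n hn).trans ?_⟩
  have hA := sum_log_div_primesLE_le (n := n) (by omega)
  have ha : 0 < Real.log n := Real.log_pos (by exact_mod_cast hn)
  have : (∑ p ∈ n.primesLE, Real.log p / p - Real.log 4) / Real.log n ≤ 1 := by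
    rw [div_le_one ha]; linarith
  linarith

theorem exists_sum_inv_sub_one_primesLE_le :
    ∃ C : ℝ, ∀ n : ℕ, 2 ≤ n →
      ∑ p ∈ n.primesLE, ((p : ℝ) - 1)⁻¹ ≤ Real.log (Real.log n) + C := by
  obtain ⟨C, hC⟩ := exists_sum_inv_primesLE_le
  have main : ∀ n : ℕ, 1 ≤ n → ∑ p ∈ n.primesLE, ((p : ℝ) - 1)⁻¹ ≤
      ∑ p ∈ n.primesLE, (p : ℝ)⁻¹ + (1 - (n : ℝ)⁻¹) := by
    intro n hn
    induction n, hn using Nat.le_induction with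
    | base => simp
    | succ n hn ih =>
      have hn' : (0 : ℝ) < n := by exact_mod_cast hn
      have hanti : ((n + 1 : ℕ) : ℝ)⁻¹ ≤ (n : ℝ)⁻¹ := by
        gcongr; omega
      rw [Nat.primesLE_succ]
      split_ifs
      · rw [Finset.sum_insert (Nat.notMem_primesLE n), Finset.sum_insert (Nat.notMem_primesLE n)]
        have : ((n + 1 : ℕ) : ℝ) - 1 = n := by push_cast; ring
        rw [this]
        linarith
      · linarith
  refine ⟨C + 1, fun n hn => (main n (by omega)).trans ?_⟩
  have := hC n hn
  have : (0 : ℝ) ≤ (n : ℝ)⁻¹ := by positivity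
  linarith

/-- If no `k`-term progression in `{1, …, N}` is rainbow, then the progressions whose differences
have few small prime factors can be counted by the monochromatic pairs. -/
theorem mul_card_le_of_forall_not_rainbow {k r A D N : ℕ} (hAD : A + (k - 1) * D ≤ N) {c : ℕ → ℕ}
    (hno : ∀ a d : ℕ, 1 ≤ a → 1 ≤ d → a + (k - 1) * d ≤ N →
      ∃ i j : ℕ, i < j ∧ j < k ∧ c (a + i * d) = c (a + j * d)) :
    A * ((Finset.Icc 1 D).filter fun d => (smallFactors k d).length ≤ r).card ≤
      (r + Nat.log 2 k + 1) ^ r *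
        (((Finset.Icc 1 N ×ˢ Finset.Icc 1 N).filter fun p => c p.1 = c p.2).card * k) := by
  set G := (Finset.Icc 1 D).filter fun d => (smallFactors k d).length ≤ r with hG
  set P := (Finset.Icc 1 N ×ˢ Finset.Icc 1 N).filter fun p => c p.1 = c p.2 with hP
  set Q := Finset.Icc 1 A ×ˢ G with hQ
  have hmem : ∀ q ∈ Q, 1 ≤ q.1 ∧ 1 ≤ q.2 ∧ q.1 + (k - 1) * q.2 ≤ N ∧
      (smallFactors k q.2).length ≤ r := by
    intro q hq
    simp only [hQ, hG, Finset.mem_product, Finset.mem_filter, Finset.mem_Icc] at hq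
    obtain ⟨⟨h1, hA⟩, ⟨h2, hD⟩, hr⟩ := hq
    exact ⟨h1, h2, (add_le_add hA (Nat.mul_le_mul_left _ hD)).trans hAD, hr⟩
  have hex : ∀ q : ℕ × ℕ, ∃ ij : ℕ × ℕ, q ∈ Q →
      ij.1 < ij.2 ∧ ij.2 < k ∧ c (q.1 + ij.1 * q.2) = c (q.1 + ij.2 * q.2) := by
    intro q
    by_cases hq : q ∈ Q
    · obtain ⟨h1, h2, h3, -⟩ := hmem q hq
      obtain ⟨i, j, h⟩ := hno q.1 q.2 h1 h2 h3
      exact ⟨(i, j), fun _ => h⟩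
    · exact ⟨(0, 0), fun h => absurd h hq⟩
  choose g hg using hex
  have hcard : Q.card = A * G.card := by simp [hQ]
  rw [← hcard]
  have hPk : P.card * k = (P ×ˢ Finset.range k).card := by simp
  rw [hPk]
  refine Finset.card_le_mul_card_image_of_maps_to
    (f := fun q => ((q.1 + (g q).1 * q.2, q.1 + (g q).2 * q.2), (g q).1)) ?_ _ ?_
  · intro q hq
    obtain ⟨h1, h2, h3, -⟩ := hmem q hq
    obtain ⟨hij, hjk, hc⟩ := hg q hq
    have hi : (g q).1 * q.2 ≤ (k - 1) * q.2 := Nat.mul_le_mul_right _ (by omega)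
    have hj : (g q).2 * q.2 ≤ (k - 1) * q.2 := Nat.mul_le_mul_right _ (by omega)
    simp only [hP, Finset.mem_product, Finset.mem_filter, Finset.mem_Icc, Finset.mem_range]
    exact ⟨⟨⟨⟨by omega, by omega⟩, by omega, by omega⟩, hc⟩, by omega⟩
  · rintro ⟨⟨x, y⟩, i⟩ -
    set F := Q.filter fun q =>
      ((q.1 + (g q).1 * q.2, q.1 + (g q).2 * q.2), (g q).1) = ((x, y), i) with hF
    have hFmem : ∀ q ∈ F, q ∈ Q ∧ x = q.1 + i * q.2 ∧ i < (g q).2 ∧ (g q).2 < k ∧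
        y - x = q.2 * ((g q).2 - i) := by
      intro q hq
      obtain ⟨hqQ, he⟩ := Finset.mem_filter.1 hq
      simp only [Prod.mk.injEq] at he
      obtain ⟨⟨hx, hy⟩, hi⟩ := he
      obtain ⟨hij, hjk, -⟩ := hg q hqQ
      rw [hi] at hx hij
      refine ⟨hqQ, hx.symm, hij, hjk, ?_⟩
      rw [← hx, ← hy, Nat.add_sub_add_left, ← Nat.sub_mul, mul_comm]
    rcases F.eq_empty_or_nonempty with h | ⟨q₀, hq₀⟩
    · simp [h]
    have hm : y - x ≠ 0 := by
      obtain ⟨hqQ, -, hij, -, he⟩ := hFmem q₀ hq₀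
      rw [he]
      exact Nat.mul_ne_zero (by have := (hmem q₀ hqQ).2.1; omega) (by omega)
    refine le_trans ?_ (card_divisors_smallFactors_le (k := k) r hm)
    refine Finset.card_le_card_of_injOn (fun q => (g q).2 - i) ?_ ?_
    · intro q hq
      obtain ⟨hqQ, -, hij, hjk, he⟩ := hFmem q hq
      have hpos : 0 < (g q).2 - i := by omega
      simp only [Finset.coe_filter, Set.mem_ofPred_eq, Finset.mem_Icc]
      refine ⟨⟨hpos, by omega⟩, ⟨q.2, by rw [he, mul_comm]⟩, ?_⟩
      rw [he, Nat.mul_div_cancel _ hpos]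
      exact (hmem q hqQ).2.2.2
    · intro q hq q' hq' hqq
      obtain ⟨-, hx, hij, -, he⟩ := hFmem q hq
      obtain ⟨-, hx', -, -, he'⟩ := hFmem q' hq'
      simp only at hqq
      rw [he, ← hqq] at he'
      have h2 : q.2 = q'.2 := Nat.eq_of_mul_eq_mul_right (by omega) he'
      refine Prod.ext ?_ h2
      rw [h2] at hx
      omega

theorem card_monochromatic_pairs {t n N : ℕ} {c : ℕ → ℕ}
    (hc : ∀ x ∈ Finset.Icc 1 N, c x ∈ Finset.Icc 1 t)
    (hn : ∀ col ∈ Finset.Icc 1 t, ((Finset.Icc 1 N).filter fun x => c x = col).card = n) :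
    ((Finset.Icc 1 N ×ˢ Finset.Icc 1 N).filter fun p => c p.1 = c p.2).card = t * n ^ 2 := by
  rw [Finset.card_eq_sum_card_fiberwise (f := fun p => c p.1) (t := Finset.Icc 1 t)]
  · have : ∀ col ∈ Finset.Icc 1 t, (((Finset.Icc 1 N ×ˢ Finset.Icc 1 N).filter
        fun p => c p.1 = c p.2).filter fun p => c p.1 = col).card = n ^ 2 := by
      intro col hcol
      rw [sq, ← hn col hcol, ← Finset.card_product]
      congr 1
      ext p
      simp only [Finset.mem_filter, Finset.mem_product]
      grind
    rw [Finset.sum_congr rfl this]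
    simp
  · intro p hp
    simp only [Finset.coe_filter, Finset.mem_product, Set.mem_ofPred_eq] at hp
    exact hc p.1 hp.1.1

theorem exists_rainbow_of_lt {k r t n : ℕ} (hk : 0 < k) (hn : 0 < n) (hkt : 2 * k ≤ t) {c : ℕ → ℕ}
    (hc : ∀ x ∈ Finset.Icc 1 (t * n), c x ∈ Finset.Icc 1 t)
    (hcn : ∀ col ∈ Finset.Icc 1 t,
      ((Finset.Icc 1 (t * n)).filter fun x => c x = col).card = n)
    (h : 8 * (k : ℝ) ^ 2 * (r + Nat.log 2 k + 1) ^ r <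
      t * (1 - (∑ p ∈ k.primesLE, ((p : ℝ) - 1)⁻¹) / (r + 1))) :
    ∃ a d : ℕ, 1 ≤ a ∧ 1 ≤ d ∧ a + (k - 1) * d ≤ t * n ∧
      ∀ i j : ℕ, i < k → j < k → i ≠ j → c (a + i * d) ≠ c (a + j * d) := by
  by_contra! hcon
  set N := t * n with hN
  have hkN : 2 * k ≤ N := hkt.trans (Nat.le_mul_of_pos_right t hn)
  set D := N / (2 * k)
  have hD : 2 * k * D ≤ N := Nat.mul_div_le N (2 * k)
  have hD' : N ≤ 4 * k * D := by
    have h1 : N < 2 * k * D + 2 * k := Nat.lt_mul_div_succ N (by omega)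
    have h2 : 1 ≤ D := Nat.div_pos hkN (by omega)
    nlinarith
  have hkD : (k - 1) * D ≤ k * D := Nat.mul_le_mul_right _ (by omega)
  have hcount := mul_card_le_of_forall_not_rainbow (k := k) (r := r) (A := N - (k - 1) * D)
    (D := D) (N := N) (c := c) (by rw [mul_assoc] at hD; omega) (by
      intro a d ha hd hadN
      obtain ⟨i, j, hi, hj, hij, hcc⟩ := hcon a d ha hd hadN
      rcases lt_or_gt_of_ne hij with hlt | hlt
      · exact ⟨i, j, hlt, hj, hcc⟩
      · exact ⟨j, i, hlt, hi, hcc.symm⟩)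
  rw [card_monochromatic_pairs hc hcn] at hcount
  have hA : (N : ℝ) / 2 ≤ ((N - (k - 1) * D : ℕ) : ℝ) := by
    have : N ≤ 2 * (N - (k - 1) * D) := by rw [mul_assoc] at hD; omega
    have : (N : ℝ) ≤ 2 * ((N - (k - 1) * D : ℕ) : ℝ) := by exact_mod_cast this
    linarith
  have hG := smallFactors.le_card_length_le k D r
  set δ := 1 - (∑ p ∈ k.primesLE, ((p : ℝ) - 1)⁻¹) / (r + 1)
  have hk' : (0 : ℝ) < k := by exact_mod_cast hk
  have ht' : (0 : ℝ) < t := by exact_mod_cast (show 0 < t by omega)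
  have hn' : (0 : ℝ) < n := by exact_mod_cast hn
  have hδ : 0 < δ := by
    refine pos_of_mul_pos_right (lt_of_le_of_lt ?_ h) ht'.le
    positivity
  have hNr : (N : ℝ) = t * n := by rw [hN]; push_cast; ring
  have hDr : (N : ℝ) / (4 * k) ≤ D := by
    rw [div_le_iff₀ (by positivity)]
    have : (N : ℝ) ≤ 4 * k * D := by exact_mod_cast hD'
    linarith
  have hcount' : ((N - (k - 1) * D : ℕ) : ℝ) *
      ((Finset.Icc 1 D).filter fun d => (smallFactors k d).length ≤ r).card ≤
      (r + Nat.log 2 k + 1) ^ r * (t * n ^ 2 * k) := by exact_mod_cast hcount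
  have hlow : (N : ℝ) / 2 * (N / (4 * k) * δ) ≤
      (r + Nat.log 2 k + 1) ^ r * (t * n ^ 2 * k) :=
    le_trans (mul_le_mul hA (le_trans (by gcongr) hG) (by positivity) (by positivity)) hcount'
  have e : (N : ℝ) / 2 * (N / (4 * k) * δ) = (t * δ) * (t * n ^ 2 / (8 * k)) := by
    rw [hNr]; field_simp; ring
  have e' : ((r : ℝ) + Nat.log 2 k + 1) ^ r * (t * n ^ 2 * k) =
      (8 * k ^ 2 * (r + Nat.log 2 k + 1) ^ r) * (t * n ^ 2 / (8 * k)) := by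
    field_simp
  rw [e, e'] at hlow
  exact absurd (le_of_mul_le_mul_right hlow (by positivity)) (not_le.2 h)

theorem eventually_exists_bound {ε : ℝ} (hε : 0 < ε) :
    ∃ k₀ : ℕ, ∀ k : ℕ, k₀ ≤ k → 2 ≤ k ∧ ∃ r : ℕ,
      8 * ((r : ℝ) + Nat.log 2 k + 1) ^ r <
        Real.exp ((1 + ε) * (Real.log (Real.log k)) ^ 2) *
          (1 - (∑ p ∈ k.primesLE, ((p : ℝ) - 1)⁻¹) / (r + 1)) := by
  obtain ⟨C, hC⟩ := exists_sum_inv_sub_one_primesLE_le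
  set β := 1 + ε / 2 with hβ
  set δ := ε / 4 / β with hδ
  have hβ0 : 0 < β := by positivity
  have hδ0 : 0 < δ := by positivity
  have hlogs : Filter.Tendsto (fun k : ℕ => Real.log (Real.log k)) Filter.atTop Filter.atTop :=
    Real.tendsto_log_atTop.comp (Real.tendsto_log_atTop.comp tendsto_natCast_atTop_atTop)
  have hev : ∀ᶠ L : ℝ in Filter.atTop, 1 ≤ L ∧ C ≤ ε / 4 * L ∧ β * L + 1 ≤ Real.exp L ∧
      Real.log 8 - Real.log δ + β * Real.log 3 * L < ε / 2 * L ^ 2 := by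
    refine (Filter.eventually_ge_atTop 1).and
      (Filter.Eventually.and ?_ (Filter.Eventually.and ?_ ?_))
    · filter_upwards [Filter.eventually_ge_atTop (C / (ε / 4))] with L hL
      rw [div_le_iff₀ (by positivity)] at hL
      linarith
    · filter_upwards [Filter.eventually_ge_atTop (2 * β)] with L hL
      have := Real.quadratic_le_exp_of_nonneg (x := L) (by linarith)
      nlinarith
    · filter_upwards [Filter.eventually_ge_atTop 1, Filter.eventually_gt_atTop
        ((|Real.log 8 - Real.log δ| + β * Real.log 3) / (ε / 2))] with L h1 hL
      rw [div_lt_iff₀ (by positivity)] at hL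
      have h3 : 0 ≤ |Real.log 8 - Real.log δ| := abs_nonneg _
      have h4 := le_abs_self (Real.log 8 - Real.log δ)
      nlinarith
  obtain ⟨k₀, hk₀⟩ := Filter.eventually_atTop.1 (hlogs.eventually hev)
  refine ⟨max k₀ 2, fun k hk => ?_⟩
  have hk2 : 2 ≤ k := (le_max_right _ _).trans hk
  obtain ⟨hL1, hLC, hLexp, hLq⟩ := hk₀ k ((le_max_left _ _).trans hk)
  have hS := hC k hk2
  have hlogk : 0 < Real.log k := Real.log_pos (by exact_mod_cast hk2)
  have hexpL : Real.exp (Real.log (Real.log k)) = Real.log k := Real.exp_log hlogk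
  set L := Real.log (Real.log k)
  set S := ∑ p ∈ k.primesLE, ((p : ℝ) - 1)⁻¹
  refine ⟨hk2, ⌊β * L⌋₊, ?_⟩
  set r := ⌊β * L⌋₊
  have hr : (r : ℝ) ≤ β * L := Nat.floor_le (by positivity)
  have hr' : β * L < r + 1 := Nat.lt_floor_add_one _
  have hfrac : δ ≤ 1 - S / (r + 1) := by
    have h1 : S / (r + 1) ≤ (1 + ε / 4) * L / (β * L) := by
      have h0 : (0 : ℝ) < β * L := by positivity
      refine (div_le_div_of_nonneg_right (c := (r : ℝ) + 1)
        (show S ≤ (1 + ε / 4) * L by linarith) (by positivity)).trans ?_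
      gcongr
    have h2 : (1 + ε / 4) * L / (β * L) = 1 - δ := by
      rw [hδ, mul_div_mul_right _ _ (by positivity : L ≠ 0)]
      field_simp
      rw [hβ]; ring
    linarith
  have hlog2 : (Nat.log 2 k : ℝ) ≤ 2 * Real.log k := by
    have h1 : (Nat.log 2 k : ℝ) ≤ Real.logb 2 k := by
      exact_mod_cast Real.natLog_le_logb k 2
    refine h1.trans ?_
    rw [Real.logb, div_le_iff₀ (Real.log_pos (by norm_num))]
    have := Real.log_two_gt_d9
    nlinarith
  have hbase : (r : ℝ) + Nat.log 2 k + 1 ≤ Real.exp (L + Real.log 3) := by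
    rw [Real.exp_add, hexpL, Real.exp_log (by norm_num)]
    rw [hexpL] at hLexp
    linarith
  have hlog3 : 0 < Real.log 3 := Real.log_pos (by norm_num)
  calc 8 * ((r : ℝ) + Nat.log 2 k + 1) ^ r ≤ 8 * (Real.exp (L + Real.log 3)) ^ r := by gcongr
    _ = Real.exp (Real.log 8 + r * (L + Real.log 3)) := by
      rw [Real.exp_add (Real.log 8), Real.exp_log (by norm_num : (0 : ℝ) < 8), Real.exp_nat_mul]
    _ ≤ Real.exp (Real.log 8 + β * L * (L + Real.log 3)) := by gcongr
    _ < Real.exp ((1 + ε) * L ^ 2 + Real.log δ) := by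
      refine Real.exp_lt_exp.2 ?_
      rw [hβ] at hLq ⊢
      linarith
    _ = Real.exp ((1 + ε) * L ^ 2) * δ := by rw [Real.exp_add, Real.exp_log hδ0]
    _ ≤ _ := by gcongr


theorem rainbow_AP_in_equinumerous_coloring :
    ∀ ε : ℝ, 0 < ε → ∃ k₀ : ℕ, ∀ k : ℕ, k₀ ≤ k →
      ∀ n : ℕ, 0 < n → ∀ c : ℕ → ℕ,
      (∀ x ∈ Finset.Icc 1
          (⌈(k : ℝ) ^ 2 * Real.exp ((1 + ε) * (Real.log (Real.log k)) ^ 2)⌉₊ * n),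
        c x ∈ Finset.Icc 1
          ⌈(k : ℝ) ^ 2 * Real.exp ((1 + ε) * (Real.log (Real.log k)) ^ 2)⌉₊) →
      (∀ col ∈ Finset.Icc 1
          ⌈(k : ℝ) ^ 2 * Real.exp ((1 + ε) * (Real.log (Real.log k)) ^ 2)⌉₊,
        ((Finset.Icc 1
            (⌈(k : ℝ) ^ 2 * Real.exp ((1 + ε) * (Real.log (Real.log k)) ^ 2)⌉₊ * n)).filter
          (fun x => c x = col)).card = n) →
      ∃ a d : ℕ, 1 ≤ a ∧ 1 ≤ d ∧
        a + (k - 1) * d ≤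
          ⌈(k : ℝ) ^ 2 * Real.exp ((1 + ε) * (Real.log (Real.log k)) ^ 2)⌉₊ * n ∧
        ∀ i j : ℕ, i < k → j < k → i ≠ j → c (a + i * d) ≠ c (a + j * d) := by
  intro ε hε
  obtain ⟨k₀, hk₀⟩ := eventually_exists_bound hε
  refine ⟨k₀, fun k hk n hn c => ?_⟩
  obtain ⟨hk2, r, hr⟩ := hk₀ k hk
  set x := (k : ℝ) ^ 2 * Real.exp ((1 + ε) * (Real.log (Real.log k)) ^ 2) with hx
  intro hc hcn
  have hk2' : (2 : ℝ) ≤ k := by exact_mod_cast hk2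
  have hxt : x ≤ ⌈x⌉₊ := Nat.le_ceil x
  have hkx : 2 * (k : ℝ) ≤ x := by
    have h1 : 1 ≤ Real.exp ((1 + ε) * (Real.log (Real.log k)) ^ 2) :=
      Real.one_le_exp (by positivity)
    rw [hx]
    nlinarith
  refine exists_rainbow_of_lt (r := r) (by omega) hn (by exact_mod_cast hkx.trans hxt) hc hcn ?_
  have hδ : 0 < 1 - (∑ p ∈ k.primesLE, ((p : ℝ) - 1)⁻¹) / (r + 1) := by
    refine pos_of_mul_pos_right (lt_of_le_of_lt ?_ hr) (Real.exp_pos _).le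
    positivity
  refine lt_of_lt_of_le ?_ (mul_le_mul_of_nonneg_right hxt hδ.le)
  have := mul_lt_mul_of_pos_left hr (show (0 : ℝ) < k ^ 2 by positivity)
  rw [hx]
  linarith
end
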